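/- Let E₁ and E₂ be real Banach spaces and let E = E₁ ⊕_∞ E₂ be their direct sum with the maximum norm ‖(x₁, x₂)‖ = max{‖x₁‖, ‖x₂‖}. Then E is a GL-space if and only if both E₁ and E₂ are GL-spaces. (This is the c₀-sum/ℓ∞-sum theorem for a family with two summands.) -/

import Mathlib

open Metric Set

/-- The slice of the closed unit ball determined by a norm-one functional `f` and `ε`:
`S(f, ε) = {x ∈ B_E : f x > 1 - ε}`. -/
def glSlice {E : Type*} [NormedAddCommGroup E] [NormedSpace ℝ E]
    (f : E →L[ℝ] ℝ) (ε : ℝ) : Set E :=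
  {x | ‖x‖ ≤ 1 ∧ 1 - ε < f x}

/-- A (real) Banach space is a generalized-lush space (GL-space) if for every `x` in the
unit sphere and every `ε > 0` there is a norm-one functional `f` with `x ∈ S(f, ε)` and
`dist(y, S(f, ε)) + dist(y, -S(f, ε)) < 2 + ε` for every `y` in the unit sphere. -/
def IsGLSpace (E : Type*) [NormedAddCommGroup E] [NormedSpace ℝ E] : Prop :=
  ∀ x : E, ‖x‖ = 1 → ∀ ε : ℝ, 0 < ε →
    ∃ f : E →L[ℝ] ℝ, ‖f‖ = 1 ∧ x ∈ glSlice f ε ∧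
      ∀ y : E, ‖y‖ = 1 →
        infDist y (glSlice f ε) + infDist y (-(glSlice f ε)) < 2 + ε

/-- A point `x` of a real normed space is a generalized-lush point if for every `ε > 0` some
norm-one functional satisfies the defining condition of a GL-space at `x`, where the sum of
distances is expressed by approximating points of the slice. -/
def IsGLPoint {E : Type*} [NormedAddCommGroup E] [NormedSpace ℝ E] (x : E) : Prop :=
  ∀ ε : ℝ, 0 < ε → ∃ f : E →L[ℝ] ℝ, ‖f‖ = 1 ∧ x ∈ glSlice f ε ∧
    ∀ y : E, ‖y‖ = 1 → ∃ a ∈ glSlice f ε, ∃ b ∈ glSlice f ε, ‖y - a‖ + ‖y + b‖ < 2 + ε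

theorem infDist_add_infDist_neg_lt_iff {E : Type*} [NormedAddCommGroup E] {S : Set E}
    (hS : S.Nonempty) (y : E) (r : ℝ) :
    infDist y S + infDist y (-S) < r ↔ ∃ a ∈ S, ∃ b ∈ S, ‖y - a‖ + ‖y + b‖ < r := by
  constructor
  · intro h
    set d := (r - (infDist y S + infDist y (-S))) / 2 with hd
    have hd0 : 0 < d := by linarith
    obtain ⟨a, ha, hya⟩ := (infDist_lt_iff hS).1 (lt_add_of_pos_right (infDist y S) hd0)
    obtain ⟨b, hb, hyb⟩ := (infDist_lt_iff hS.neg).1 (lt_add_of_pos_right (infDist y (-S)) hd0)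
    refine ⟨a, ha, -b, hb, ?_⟩
    rw [dist_eq_norm] at hya hyb
    rw [← sub_eq_add_neg]
    linarith
  · rintro ⟨a, ha, b, hb, h⟩
    have h₁ := infDist_le_dist_of_mem (x := y) ha
    have h₂ := infDist_le_dist_of_mem (x := y) (Set.neg_mem_neg.2 hb)
    rw [dist_eq_norm] at h₁ h₂
    rw [sub_neg_eq_add] at h₂
    linarith

section

variable {E F : Type*} [NormedAddCommGroup E] [NormedSpace ℝ E]
  [NormedAddCommGroup F] [NormedSpace ℝ F]

theorem isGLSpace_iff_forall_isGLPoint :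
    IsGLSpace E ↔ ∀ x : E, ‖x‖ = 1 → IsGLPoint x := by
  refine forall₄_congr fun x _ ε _ ↦ exists_congr fun f ↦ and_congr_right fun _ ↦
    and_congr_right fun hxf ↦ forall₂_congr fun y _ ↦ ?_
  exact infDist_add_infDist_neg_lt_iff ⟨x, hxf⟩ y (2 + ε)

theorem IsGLPoint.map {x : E} (hx : IsGLPoint x) (e : E ≃ₗᵢ[ℝ] F) : IsGLPoint (e x) := by
  intro ε hε
  obtain ⟨f, hf, hxf, h⟩ := hx ε hε
  have hmem : ∀ a ∈ glSlice f ε,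
      e a ∈ glSlice (f.comp (e.symm.toContinuousLinearEquiv : F →L[ℝ] E)) ε := by
    rintro a ⟨ha₁, ha₂⟩
    exact ⟨by simpa using ha₁, by simpa using ha₂⟩
  refine ⟨f.comp (e.symm.toContinuousLinearEquiv : F →L[ℝ] E), ?_, hmem x hxf, fun y hy ↦ ?_⟩
  · exact (f.opNorm_comp_linearIsometryEquiv e.symm).trans hf
  · obtain ⟨a, ha, b, hb, hab⟩ := h (e.symm y) (by simpa using hy)
    refine ⟨e a, hmem a ha, e b, hmem b hb, ?_⟩
    rw [← e.norm_map (e.symm y - a), ← e.norm_map (e.symm y + b)] at hab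
    simpa using hab

theorem IsGLSpace.map (h : IsGLSpace E) (e : E ≃ₗᵢ[ℝ] F) : IsGLSpace F := by
  rw [isGLSpace_iff_forall_isGLPoint] at h ⊢
  intro x hx
  simpa using (h (e.symm x) (by simpa using hx)).map e

theorem convex_glSlice (f : E →L[ℝ] ℝ) (ε : ℝ) : Convex ℝ (glSlice f ε) := by
  have h : glSlice f ε = closedBall 0 1 ∩ {x | 1 - ε < f x} := by
    ext x
    simp [glSlice]
  rw [h]
  exact (convex_closedBall 0 1).inter (convex_halfSpace_gt f.toLinearMap.isLinear _)

/-- If `S` is convex, then the set of points `y` admitting `a, b ∈ S` with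
`‖y - a‖ + ‖y + b‖ < r` contains, with each `u`, the segment from `-u` to `u`. -/
theorem Convex.exists_norm_sub_add_norm_add_lt_smul {S : Set E} (hS : Convex ℝ S) {u : E} {r : ℝ}
    (h : ∃ a ∈ S, ∃ b ∈ S, ‖u - a‖ + ‖u + b‖ < r) {t : ℝ} (ht : |t| ≤ 1) :
    ∃ a ∈ S, ∃ b ∈ S, ‖t • u - a‖ + ‖t • u + b‖ < r := by
  obtain ⟨a, ha, b, hb, hab⟩ := h
  obtain ⟨ht₁, ht₂⟩ := abs_le.1 ht
  have hp : 0 ≤ (1 + t) / 2 := by linarith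
  have hq : 0 ≤ (1 - t) / 2 := by linarith
  refine ⟨((1 + t) / 2) • a + ((1 - t) / 2) • b, hS ha hb hp hq (by ring),
    ((1 + t) / 2) • b + ((1 - t) / 2) • a, hS hb ha hp hq (by ring), ?_⟩
  have h₁ : t • u - (((1 + t) / 2) • a + ((1 - t) / 2) • b) =
      ((1 + t) / 2) • (u - a) - ((1 - t) / 2) • (u + b) := by module
  have h₂ : t • u + (((1 + t) / 2) • b + ((1 - t) / 2) • a) =
      ((1 + t) / 2) • (u + b) - ((1 - t) / 2) • (u - a) := by module
  have h₃ := norm_sub_le (((1 + t) / 2) • (u - a)) (((1 - t) / 2) • (u + b))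
  have h₄ := norm_sub_le (((1 + t) / 2) • (u + b)) (((1 - t) / 2) • (u - a))
  simp only [norm_smul_of_nonneg hp, norm_smul_of_nonneg hq] at h₃ h₄
  rw [h₁, h₂]
  linarith

theorem exists_eq_smul_of_norm_le_one {x : E} (hx : ‖x‖ = 1) {y : E} (hy : ‖y‖ ≤ 1) :
    ∃ (u : E) (t : ℝ), ‖u‖ = 1 ∧ |t| ≤ 1 ∧ y = t • u := by
  rcases eq_or_ne y 0 with rfl | h0
  · exact ⟨x, 0, hx, by simp, by simp⟩
  · refine ⟨‖y‖⁻¹ • y, ‖y‖, norm_smul_inv_norm (𝕜 := ℝ) h0, by simpa using hy, ?_⟩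
    rw [smul_inv_smul₀ (norm_ne_zero_iff.2 h0)]

theorem IsGLPoint.prodMk {x : E} (hx₁ : ‖x‖ = 1) (hx : IsGLPoint x) {z : F} (hz : ‖z‖ ≤ 1) :
    IsGLPoint (x, z) := by
  intro ε hε
  obtain ⟨f, hf, hxf, h⟩ := hx ε hε
  have hmem : ∀ a ∈ glSlice f ε, ∀ w : F, ‖w‖ ≤ 1 →
      (a, w) ∈ glSlice (f.comp (ContinuousLinearMap.fst ℝ E F)) ε :=
    fun a ha w hw ↦ ⟨max_le ha.1 hw, ha.2⟩
  refine ⟨f.comp (ContinuousLinearMap.fst ℝ E F), ?_, hmem x hxf z hz, ?_⟩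
  · refine le_antisymm ?_ ?_
    · refine ContinuousLinearMap.opNorm_le_bound _ zero_le_one fun p ↦ ?_
      refine (f.le_opNorm p.1).trans ?_
      rw [hf]
      gcongr
      exact norm_fst_le p
    · rw [← hf]
      refine ContinuousLinearMap.opNorm_le_bound _ (norm_nonneg _) fun w ↦ ?_
      simpa using (f.comp (ContinuousLinearMap.fst ℝ E F)).le_opNorm (w, 0)
  · rintro ⟨y, w⟩ hyw
    have hy : ‖y‖ ≤ 1 := (norm_fst_le (y, w)).trans hyw.le
    have hw : ‖w‖ ≤ 1 := (norm_snd_le (y, w)).trans hyw.le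
    obtain ⟨u, t, hu, ht, rfl⟩ := exists_eq_smul_of_norm_le_one hx₁ hy
    obtain ⟨a, ha, b, hb, hab⟩ :=
      (convex_glSlice f ε).exists_norm_sub_add_norm_add_lt_smul (h u hu) ht
    refine ⟨(a, w), hmem a ha w hw, (b, -w), hmem b hb (-w) (by simpa using hw), ?_⟩
    simpa [Prod.norm_def] using hab

theorem IsGLSpace.prod (hE : IsGLSpace E) (hF : IsGLSpace F) : IsGLSpace (E × F) := by
  rw [isGLSpace_iff_forall_isGLPoint] at *
  rintro ⟨x, z⟩ h
  have hx : ‖x‖ ≤ 1 := (norm_fst_le (x, z)).trans h.le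
  have hz : ‖z‖ ≤ 1 := (norm_snd_le (x, z)).trans h.le
  rcases max_choice ‖x‖ ‖z‖ with hmax | hmax
  · have hx₁ : ‖x‖ = 1 := hmax.symm.trans h
    exact (hE x hx₁).prodMk hx₁ hz
  · have hz₁ : ‖z‖ = 1 := hmax.symm.trans h
    exact ((hF z hz₁).prodMk hz₁ hx).map (LinearIsometryEquiv.prodComm ℝ F E)

theorem IsGLSpace.of_prod (h : IsGLSpace (E × F)) : IsGLSpace E := by
  rw [isGLSpace_iff_forall_isGLPoint] at *
  intro x hx ε hε
  obtain ⟨δ, hδ, hδε, hδ1⟩ : ∃ δ : ℝ, 0 < δ ∧ 2 * δ ≤ ε ∧ 2 * δ ≤ 1 :=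
    ⟨min ε 1 / 2, by positivity, by linarith [min_le_left ε 1], by linarith [min_le_right ε 1]⟩
  obtain ⟨f, hf, hxf, H⟩ := h (x, 0) (by simp [hx]) δ hδ
  have hle : ∀ p, ‖p‖ ≤ 1 → f p ≤ 1 := fun p hp ↦
    (le_abs_self _).trans ((f.le_opNorm p).trans (by rw [hf, one_mul]; exact hp))
  set g : E →L[ℝ] ℝ := f.comp (ContinuousLinearMap.inl ℝ E F) with hg
  have hgx : 1 - δ < g x := hxf.2
  have hsplit : ∀ a b, f (a, b) = g a + f (0, b) := by
    intro a b
    simp [hg, ← map_add]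
  have hg1 : ‖g‖ ≤ 1 := by
    refine ContinuousLinearMap.opNorm_le_bound _ zero_le_one fun w ↦ ?_
    simpa [hg, hf] using f.le_opNorm (w, 0)
  have hg0 : 0 < ‖g‖ := by
    rw [norm_pos_iff]
    intro h0
    rw [h0, zero_apply] at hgx
    linarith
  have hmem : ∀ p ∈ glSlice f δ, p.1 ∈ glSlice (‖g‖⁻¹ • g) ε := by
    rintro ⟨a, b⟩ ⟨hab, hfab⟩
    have hb : ‖b‖ ≤ 1 := (norm_snd_le (a, b)).trans hab
    have hxb := hle (x, b) (max_le hx.le hb)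
    rw [hsplit] at hxb hfab
    have hga : 1 - 2 * δ < g a := by linarith
    refine ⟨(norm_fst_le (a, b)).trans hab, ?_⟩
    have : g a ≤ ‖g‖⁻¹ * g a :=
      le_mul_of_one_le_left (by linarith) ((one_le_inv₀ hg0).2 hg1)
    change 1 - ε < ‖g‖⁻¹ * g a
    linarith
  refine ⟨‖g‖⁻¹ • g, norm_smul_inv_norm (𝕜 := ℝ) (norm_pos_iff.1 hg0), hmem (x, 0) hxf,
    fun y hy ↦ ?_⟩
  obtain ⟨a, ha, b, hb, hab⟩ := H (y, 0) (by simp [hy])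
  refine ⟨a.1, hmem a ha, b.1, hmem b hb, ?_⟩
  have h₁ : ‖y - a.1‖ ≤ ‖(y, 0) - a‖ := norm_fst_le ((y, 0) - a)
  have h₂ : ‖y + b.1‖ ≤ ‖(y, 0) + b‖ := norm_fst_le ((y, 0) + b)
  linarith

end

/-- Theorem 2.11 (two-summand ℓ∞/c₀-sum case): `E₁ ⊕_∞ E₂` (the product with the maximum
norm, which is the norm of `E₁ × E₂` in mathlib) is a GL-space iff both `E₁` and `E₂`
are GL-spaces. -/
theorem stmt_9 {E₁ E₂ : Type*} [NormedAddCommGroup E₁] [NormedSpace ℝ E₁]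
    [CompleteSpace E₁] [NormedAddCommGroup E₂] [NormedSpace ℝ E₂] [CompleteSpace E₂] :
    IsGLSpace (E₁ × E₂) ↔ IsGLSpace E₁ ∧ IsGLSpace E₂ := by
  exact ⟨fun h ↦ ⟨h.of_prod, (h.map (LinearIsometryEquiv.prodComm ℝ E₁ E₂)).of_prod⟩,
    fun h ↦ h.1.prod h.2⟩
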